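/- arXiv:2204.10257 — 2 statements merged into one kernel-verified Lean document; each statement's English description precedes it below -/
import Mathlib

section
/- Suppose ζ : I → ℝ^n is sufficiently smooth on an interval I and the Jacobian J_Φ(t_1, ..., t_n) = det[ζ'(t_1), ..., ζ'(t_n)] of the map Φ(t_1, ..., t_n) = ζ(t_1) + ... + ζ(t_n) is strictly positive (or strictly negative) on the region {t_1 < t_2 < ... < t_n} ⊂ I^n, and similarly for every 1 ≤ m ≤ n the corresponding Jacobian for the truncation (ζ_1, ..., ζ_m) is single-signed and nonzero on {t_1 < ... < t_m}. Then Φ is injective on {(t_1, ..., t_n) ∈ I^n : t_1 < t_2 < ... < t_n}. -/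
theorem steinig_points (I : Set ℝ) : ∀ (n : ℕ) (t s : Fin n → ℝ), StrictMono t → StrictMono s →
    (∀ i, t i ∈ I) → (∀ i, s i ∈ I) → t ≠ s →
    ∃ (X : Finset ℝ) (δ : ℝ) (l : Fin n), (∀ x ∈ X, x ∈ I) ∧ X.card + 1 ≤ n ∧
      (∀ i, t i ≠ s i → i ≤ l) ∧ (∀ x ∈ X, x < min (t l) (s l)) ∧
      0 < δ * (t l - s l) * (-1) ^ X.card ∧
      ∀ i, t i ≠ s i → ∀ y, min (t i) (s i) < y → y < max (t i) (s i) →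
        y ∉ X ∧ 0 < δ * (t i - s i) * (-1) ^ (X.filter (· < y)).card := by
  intro n
  induction n with
  | zero => intro t s _ _ _ _ h; exact absurd (Subsingleton.elim t s) h
  | succ n ih =>
    intro t s ht hs htI hsI hne
    by_cases h0 : (fun i : Fin n => t i.castSucc) = (fun i : Fin n => s i.castSucc)
    · have h0' : ∀ i : Fin n, t i.castSucc = s i.castSucc := fun i => congrFun h0 i
      have hl : t (Fin.last n) ≠ s (Fin.last n) := by
        intro h
        apply hne
        funext i
        exact Fin.lastCases h h0' i
      have hpos : 0 < (t (Fin.last n) - s (Fin.last n)) * (t (Fin.last n) - s (Fin.last n)) :=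
        mul_self_pos.2 (sub_ne_zero.2 hl)
      refine ⟨∅, t (Fin.last n) - s (Fin.last n), Fin.last n, by simp, by simp,
        fun i _ => Fin.le_last i, by simp, by simpa using hpos, ?_⟩
      intro i
      refine Fin.lastCases ?_ ?_ i
      · intro _ y _ _
        simpa using hpos
      · intro i hi
        exact absurd (h0' i) hi
    · obtain ⟨X, δ, l, hXI, hXc, hl, hXl, hsgn, hall⟩ := ih _ _
        (ht.comp (Fin.strictMono_castSucc)) (hs.comp (Fin.strictMono_castSucc))
        (fun i => htI i.castSucc) (fun i => hsI i.castSucc) h0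
      simp only [Function.comp_apply] at hl hXl hsgn hall
      have htl : t l.castSucc < t (Fin.last n) := ht (Fin.castSucc_lt_last l)
      have hsl : s l.castSucc < s (Fin.last n) := hs (Fin.castSucc_lt_last l)
      by_cases he : t (Fin.last n) = s (Fin.last n)
      · refine ⟨X, δ, l.castSucc, hXI, by omega, ?_, hXl, hsgn, ?_⟩
        · intro i
          refine Fin.lastCases (fun h => absurd he h) (fun i hi => ?_) i
          exact Fin.castSucc_le_castSucc_iff.2 (hl i hi)
        · intro i
          refine Fin.lastCases (fun h => absurd he h) (fun i hi => ?_) i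
          exact hall i hi
      have hminlt : min (t l.castSucc) (s l.castSucc) < min (t (Fin.last n)) (s (Fin.last n)) :=
        min_lt_min htl hsl
      by_cases hsame : 0 < (t l.castSucc - s l.castSucc) * (t (Fin.last n) - s (Fin.last n))
      · have key : 0 < δ * (t (Fin.last n) - s (Fin.last n)) * (-1) ^ X.card := by
          have h1 := mul_pos hsgn hsame
          have h2 : 0 < (t l.castSucc - s l.castSucc) ^ 2 := by
            have : t l.castSucc - s l.castSucc ≠ 0 := left_ne_zero_of_mul hsame.ne'
            positivity
          refine pos_of_mul_pos_right (a := (t l.castSucc - s l.castSucc) ^ 2) ?_ h2.le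
          nlinarith [h1]
        refine ⟨X, δ, Fin.last n, hXI, by omega, fun i _ => Fin.le_last i,
          fun x hx => (hXl x hx).trans hminlt, key, ?_⟩
        intro i
        refine Fin.lastCases (fun _ y hy1 _ => ?_) (fun i hi => hall i hi) i
        have hlt : ∀ x ∈ X, x < y := fun x hx => ((hXl x hx).trans hminlt).trans hy1
        refine ⟨fun h => lt_irrefl _ (hlt y h), ?_⟩
        rw [Finset.filter_true_of_mem hlt]
        exact key
      · have hlne : t l.castSucc - s l.castSucc ≠ 0 := by
          intro h; rw [h] at hsgn; simp at hsgn
        have hane : t (Fin.last n) - s (Fin.last n) ≠ 0 := sub_ne_zero.2 he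
        have hopp : (t l.castSucc - s l.castSucc) * (t (Fin.last n) - s (Fin.last n)) < 0 :=
          lt_of_le_of_ne (not_lt.1 hsame) (mul_ne_zero hlne hane)
        set z := max (t l.castSucc) (s l.castSucc) with hz
        have hzX : ∀ x ∈ X, x < z := fun x hx => (hXl x hx).trans_le (min_le_max)
        have hznot : z ∉ X := fun h => lt_irrefl _ (hzX z h)
        have hzlt : z < min (t (Fin.last n)) (s (Fin.last n)) := by
          rcases mul_neg_iff.1 hopp with ⟨h1, h2⟩ | ⟨h1, h2⟩
          · rw [hz, max_eq_left (by linarith), min_eq_left (by linarith)]; exact htl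
          · rw [hz, max_eq_right (by linarith), min_eq_right (by linarith)]; exact hsl
        have hcard : (insert z X).card = X.card + 1 := Finset.card_insert_of_notMem hznot
        have key : 0 < δ * (t (Fin.last n) - s (Fin.last n)) * (-1) ^ (insert z X).card := by
          rw [hcard, pow_succ]
          have h1 := mul_neg_of_pos_of_neg hsgn hopp
          have h2 : 0 < (t l.castSucc - s l.castSucc) ^ 2 := by positivity
          refine pos_of_mul_pos_right (a := (t l.castSucc - s l.castSucc) ^ 2) ?_ h2.le
          nlinarith [h1]
        have hlt' : ∀ x ∈ insert z X, x < min (t (Fin.last n)) (s (Fin.last n)) := by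
          intro x hx
          rcases Finset.mem_insert.1 hx with rfl | hx
          · exact hzlt
          · exact (hzX x hx).trans hzlt
        refine ⟨insert z X, δ, Fin.last n, ?_, by omega, fun i _ => Fin.le_last i, hlt', key, ?_⟩
        · intro x hx
          rcases Finset.mem_insert.1 hx with rfl | hx
          · rcases max_choice (t l.castSucc) (s l.castSucc) with h | h
            · rw [hz, h]; exact htI _
            · rw [hz, h]; exact hsI _
          · exact hXI x hx
        · intro i
          refine Fin.lastCases (fun _ y hy1 _ => ?_) (fun i hi y hy1 hy2 => ?_) i
          · have hlt : ∀ x ∈ insert z X, x < y := fun x hx => (hlt' x hx).trans hy1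
            refine ⟨fun h => lt_irrefl _ (hlt y h), ?_⟩
            rw [Finset.filter_true_of_mem hlt]
            exact key
          · have hil : i.castSucc ≤ l.castSucc := Fin.castSucc_le_castSucc_iff.2 (hl i hi)
            have hyz : y < z :=
              hy2.trans_le (max_le_max (ht.monotone hil) (hs.monotone hil))
            obtain ⟨ha, hb⟩ := hall i hi y hy1 hy2
            refine ⟨fun h => ?_, ?_⟩
            · rcases Finset.mem_insert.1 h with h | h
              · exact hyz.ne h
              · exact ha h
            · rw [Finset.filter_insert, if_neg (not_lt.2 hyz.le)]
              exact hb

/-- The interpolating combination. -/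
theorem steinig_comb (p : ℕ) (I : Set ℝ) (f : Fin (p + 1) → ℝ → ℝ) (ε : ℝ)
    (h : ∀ u : Fin (p + 1) → ℝ, (∀ i, u i ∈ I) → StrictMono u →
        0 < ε * Matrix.det (Matrix.of fun i j : Fin (p + 1) => f i (u j)))
    (X : Finset ℝ) (hX : X.card = p) (hXI : ∀ x ∈ X, x ∈ I) :
    ∃ c : Fin (p + 1) → ℝ, ∀ y ∈ I, y ∉ X →
      0 < ε * (-1) ^ (X.filter (· < y)).card * ∑ i, c i * f i y := by
  let x : Fin p → ℝ := X.orderEmbOfFin hX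
  have hx : StrictMono x := (X.orderEmbOfFin hX).strictMono
  have hxm : ∀ j, x j ∈ X := fun j => Finset.orderEmbOfFin_mem X hX j
  refine ⟨fun i => (-1) ^ (i : ℕ) *
    Matrix.det (Matrix.of fun a b : Fin p => f (i.succAbove a) (x b)), ?_⟩
  intro y hy hyX
  have hXim : X = Finset.univ.image x := by
    apply Finset.coe_injective
    rw [Finset.coe_image, Finset.coe_univ, Set.image_univ]
    exact (Finset.range_orderEmbOfFin X hX).symm
  set q := (X.filter (· < y)).card with hq
  have hqp : q < p + 1 := by
    have := Finset.card_filter_le X (· < y)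
    omega
  have hqc : q = (Finset.univ.filter (fun j : Fin p => x j < y)).card := by
    rw [hq]
    conv_lhs => rw [hXim]
    rw [Finset.filter_image, Finset.card_image_of_injective _ hx.injective]
  have hiff : ∀ j : Fin p, x j < y ↔ (j : ℕ) < q := by
    intro j
    constructor
    · intro hj
      have hsub : Finset.Iic j ⊆ Finset.univ.filter (fun j : Fin p => x j < y) := by
        intro k hk
        simp only [Finset.mem_filter, Finset.mem_univ, true_and]
        exact (hx.monotone (Finset.mem_Iic.1 hk)).trans_lt hj
      have := Finset.card_le_card hsub
      rw [Fin.card_Iic, ← hqc] at this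
      omega
    · intro hj
      by_contra hn
      have hsub : Finset.univ.filter (fun j : Fin p => x j < y) ⊆ Finset.Iio j := by
        intro k hk
        simp only [Finset.mem_filter, Finset.mem_univ, true_and] at hk
        rw [Finset.mem_Iio]
        exact hx.lt_iff_lt.1 (hk.trans_le (not_lt.1 hn))
      have := Finset.card_le_card hsub
      rw [Fin.card_Iio, ← hqc] at this
      omega
  let Q : Fin (p + 1) := ⟨q, hqp⟩
  have hmono : StrictMono (Q.insertNth y x : Fin (p + 1) → ℝ) := by
    intro a b hab
    rcases Fin.eq_self_or_eq_succAbove Q a with rfl | ⟨a, rfl⟩ <;>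
    rcases Fin.eq_self_or_eq_succAbove Q b with rfl | ⟨b, rfl⟩
    · exact absurd hab (lt_irrefl _)
    · rw [Fin.insertNth_apply_same, Fin.insertNth_apply_succAbove]
      refine lt_of_le_of_ne (not_lt.1 fun hb => ?_) (fun e => hyX (e ▸ hxm b))
      have h1 := (hiff b).1 hb
      rw [Fin.succAbove_of_castSucc_lt _ _ (by simpa [Fin.lt_def, Q] using h1)] at hab
      simp [Fin.lt_def, Q] at hab
      omega
    · rw [Fin.insertNth_apply_same, Fin.insertNth_apply_succAbove]
      refine (hiff a).2 ?_
      by_contra hn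
      rw [Fin.succAbove_of_le_castSucc _ _ (by simpa [Fin.le_def, Q] using hn)] at hab
      simp [Fin.lt_def, Q] at hab
      omega
    · rw [Fin.insertNth_apply_succAbove, Fin.insertNth_apply_succAbove]
      exact hx ((Fin.strictMono_succAbove Q).lt_iff_lt.1 hab)
  have hmem : ∀ i, (Q.insertNth y x : Fin (p + 1) → ℝ) i ∈ I := by
    intro a
    rcases Fin.eq_self_or_eq_succAbove Q a with rfl | ⟨a, rfl⟩
    · rw [Fin.insertNth_apply_same]; exact hy
    · rw [Fin.insertNth_apply_succAbove]; exact hXI _ (hxm a)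
  have := h _ hmem hmono
  rw [Matrix.det_succ_column _ Q] at this
  convert this using 1
  rw [mul_assoc, Finset.mul_sum]
  congr 1
  refine Finset.sum_congr rfl fun i _ => ?_
  have hsub : (Matrix.of fun i j : Fin (p + 1) =>
      f i ((Q.insertNth y x : Fin (p + 1) → ℝ) j)).submatrix i.succAbove Q.succAbove =
      Matrix.of fun a b : Fin p => f (i.succAbove a) (x b) := by
    ext a b
    simp [Fin.insertNth_apply_succAbove]
  rw [hsub, Matrix.of_apply, Fin.insertNth_apply_same, pow_add]
  ring


/-- Steinig's injectivity argument: if for every `1 ≤ m ≤ n` the Jacobian determinant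
`det[η'(u_1), ..., η'(u_m)]` of the truncation `η = (ζ_1, ..., ζ_m)` is single-signed and
nonzero for `u_1 < ⋯ < u_m` in `I`, then `Φ(t_1,...,t_n) = ζ(t_1) + ⋯ + ζ(t_n)` is
injective on the region `t_1 < t_2 < ⋯ < t_n` of `I^n`. -/
theorem statement4 (n : ℕ) (hn : 1 ≤ n) (I : Set ℝ) (hI : Convex ℝ I)
    (ζ : Fin n → ℝ → ℝ) (hζ : ∀ c, ContDiff ℝ 1 (ζ c))
    (hsign : ∀ (m : ℕ) (hm : m ≤ n), 1 ≤ m → ∃ ε : ℝ, (ε = 1 ∨ ε = -1) ∧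
      ∀ u : Fin m → ℝ, (∀ i, u i ∈ I) → StrictMono u →
        0 < ε * Matrix.det (Matrix.of fun i j : Fin m =>
          deriv (ζ (Fin.castLE hm i)) (u j))) :
    Set.InjOn (fun t : Fin n → ℝ => (fun c : Fin n => ∑ i, ζ c (t i)))
      {t : Fin n → ℝ | (∀ i, t i ∈ I) ∧ StrictMono t} := by
  rintro t ⟨htI, ht⟩ s ⟨hsI, hs⟩ hts
  by_contra hne
  obtain ⟨X, δ, l, hXI, hXc, -, -, hl, hall⟩ := steinig_points I n t s ht hs htI hsI hne
  obtain ⟨ε, -, hε⟩ := hsign (X.card + 1) hXc (by omega)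
  obtain ⟨c, hc⟩ := steinig_comb X.card I (fun i => deriv (ζ (Fin.castLE hXc i))) ε hε X rfl hXI
  let G : ℝ → ℝ := fun y => ∑ i, c i * ζ (Fin.castLE hXc i) y
  have hdiff : ∀ a y, DifferentiableAt ℝ (ζ a) y := fun a y =>
    ((hζ a).differentiable (by norm_num)) y
  have hG : ∀ y, HasDerivAt G (∑ i, c i * deriv (ζ (Fin.castLE hXc i)) y) y := by
    intro y
    exact HasDerivAt.fun_sum fun i _ => ((hdiff _ y).hasDerivAt).const_mul (c i)
  have hGc : Continuous G := continuous_iff_continuousAt.2 fun y => (hG y).continuousAt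
  have hsum : ∑ i, (G (t i) - G (s i)) = 0 := by
    have e : ∀ r : Fin n → ℝ, ∑ i, G (r i) =
        ∑ a, c a * ∑ i, ζ (Fin.castLE hXc a) (r i) := by
      intro r
      simp only [G, Finset.mul_sum]
      exact Finset.sum_comm
    rw [Finset.sum_sub_distrib, e, e, sub_eq_zero]
    refine Finset.sum_congr rfl fun a _ => ?_
    have := congrFun hts (Fin.castLE hXc a)
    simp only at this
    rw [this]
  have hterm : ∀ i, t i ≠ s i → 0 < δ * ε * (G (t i) - G (s i)) := by
    intro i hi
    have hlt : min (t i) (s i) < max (t i) (s i) := min_lt_max.2 hi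
    obtain ⟨y, ⟨hy1, hy2⟩, hy⟩ := exists_hasDerivAt_eq_slope G _ hlt hGc.continuousOn
      (fun y _ => hG y)
    have hyI : y ∈ I := by
      have ho := hI.ordConnected
      rcases lt_or_gt_of_ne hi with h | h
      · rw [min_eq_left h.le] at hy1
        rw [max_eq_right h.le] at hy2
        exact ho.out (htI i) (hsI i) ⟨hy1.le, hy2.le⟩
      · rw [min_eq_right h.le] at hy1
        rw [max_eq_left h.le] at hy2
        exact ho.out (hsI i) (htI i) ⟨hy1.le, hy2.le⟩
    obtain ⟨hyX, hs1⟩ := hall i hi y hy1 hy2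
    have hs2 := hc y hyI hyX
    have hslope : G (t i) - G (s i) =
        (∑ j, c j * deriv (ζ (Fin.castLE hXc j)) y) * (t i - s i) := by
      rw [hy]
      rcases lt_or_gt_of_ne hi with h | h
      · rw [min_eq_left h.le, max_eq_right h.le]
        have : s i - t i ≠ 0 := sub_ne_zero.2 hi.symm
        field_simp
        ring
      · rw [min_eq_right h.le, max_eq_left h.le]
        have : t i - s i ≠ 0 := sub_ne_zero.2 hi
        field_simp
    have hprod := mul_pos hs1 hs2
    rw [hslope]
    have hsq : ((-1 : ℝ) ^ (X.filter (· < y)).card) * (-1) ^ (X.filter (· < y)).card = 1 := by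
      rw [← mul_pow]; norm_num
    calc (0 : ℝ) < _ := hprod
      _ = δ * ε * ((∑ j, c j * deriv (ζ (Fin.castLE hXc j)) y) * (t i - s i)) *
          (((-1 : ℝ) ^ (X.filter (· < y)).card) * (-1) ^ (X.filter (· < y)).card) := by ring
      _ = _ := by rw [hsq, mul_one]
  have hlne : t l ≠ s l := by
    intro h; rw [h] at hl; simp at hl
  have hpos : 0 < ∑ i, δ * ε * (G (t i) - G (s i)) := by
    refine Finset.sum_pos' (fun i _ => ?_) ⟨l, Finset.mem_univ l, hterm l hlne⟩
    by_cases h : t i = s i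
    · rw [h]; simp
    · exact (hterm i h).le
  rw [← Finset.mul_sum, hsum, mul_zero] at hpos
  exact lt_irrefl _ hpos
end

section
/- Let ζ : I → ℝ^n be smooth on an interval I, and let L_j(t) = det[(ζ_i^{(l)}(t))_{1 ≤ i,l ≤ j}] for 1 ≤ j ≤ n, with L_0 = L_{−1} ≡ 1. For 1 ≤ j < i ≤ n define L_{ζ_1 ⋯ ζ_{j−1} ζ_i}(t) as the determinant of the j×j matrix with rows ζ_1, ..., ζ_{j−1}, ζ_i and columns the derivatives of orders 1 through j. If L_j never vanishes on I, then the derivative of the quotient L_{ζ_1 ⋯ ζ_{j−1} ζ_i} / L_{ζ_1 ⋯ ζ_j} equals (L_{ζ_1 ⋯ ζ_{j−1}} · L_{ζ_1 ⋯ ζ_j ζ_i}) / (L_{ζ_1 ⋯ ζ_j})². -/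
/-- Generalized minor: for a choice of rows `ρ : Fin l → Fin n`,
`Lg n l ζ ρ t` is the determinant of the `l × l` matrix whose `(p, q)` entry is
`ζ_{ρ(p)}^{(q+1)}(t)`. -/
noncomputable def Lg (n l : ℕ) (ζ : Fin n → ℝ → ℝ) (ρ : Fin l → Fin n) (t : ℝ) : ℝ :=
  Matrix.det (Matrix.of fun p q : Fin l => iteratedDeriv ((q : ℕ) + 1) (ζ (ρ p)) t)

open Matrix in
lemma dj_inv {m : ℕ} (A : Matrix (Fin m) (Fin m) ℝ) (B : Matrix (Fin m) (Fin 2) ℝ)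
    (C : Matrix (Fin 2) (Fin m) ℝ) (D : Matrix (Fin 2) (Fin 2) ℝ)
    (E : Fin 2 → Fin 2 → ℝ)
    (hE : ∀ p q, E p q = (fromBlocks A (B.submatrix id (fun _ : Fin 1 => q))
      (C.submatrix (fun _ : Fin 1 => p) id)
      (D.submatrix (fun _ : Fin 1 => p) (fun _ : Fin 1 => q))).det) (hA : A.det ≠ 0) :
    A.det * (fromBlocks A B C D).det = E 0 0 * E 1 1 - E 0 1 * E 1 0 := by
  have : Invertible A := A.invertibleOfIsUnitDet (Ne.isUnit hA)
  have h : ∀ p q, E p q = A.det * (D - C * ⅟A * B) p q := by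
    intro p q
    rw [hE, det_fromBlocks₁₁]
    congr 1
    rw [det_fin_one]
    rfl
  rw [h, h, h, h, det_fromBlocks₁₁, det_fin_two]
  ring

open Matrix in
lemma dj {m : ℕ} (A : Matrix (Fin m) (Fin m) ℝ) (B : Matrix (Fin m) (Fin 2) ℝ)
    (C : Matrix (Fin 2) (Fin m) ℝ) (D : Matrix (Fin 2) (Fin 2) ℝ)
    (E : Matrix (Fin m) (Fin m) ℝ → Fin 2 → Fin 2 → ℝ)
    (hE : ∀ A p q, E A p q = (fromBlocks A (B.submatrix id (fun _ : Fin 1 => q))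
      (C.submatrix (fun _ : Fin 1 => p) id)
      (D.submatrix (fun _ : Fin 1 => p) (fun _ : Fin 1 => q))).det) :
    A.det * (fromBlocks A B C D).det = E A 0 0 * E A 1 1 - E A 0 1 * E A 1 0 := by
  have hd : Dense {x : ℝ | (Matrix.scalar (Fin m) x + A).det ≠ 0} := by
    have hfin : {x : ℝ | (Matrix.scalar (Fin m) x + A).det = 0}.Finite := by
      refine ((-A).charpoly.roots.toFinset.finite_toSet).subset ?_
      intro x hx
      have hx' : (Matrix.scalar (Fin m) x + A).det = 0 := hx
      simp only [Finset.mem_coe, Multiset.mem_toFinset]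
      rw [Polynomial.mem_roots (Matrix.charpoly_monic _).ne_zero, Polynomial.IsRoot.def,
        Matrix.eval_charpoly, sub_neg_eq_add, hx']
    have := hfin.countable.dense_compl ℝ
    exact this
  have hc : Continuous fun x : ℝ => Matrix.scalar (Fin m) x + A := by
    refine Continuous.add ?_ continuous_const
    exact Continuous.matrix_diagonal (continuous_pi fun _ => continuous_id)
  have hEc : ∀ p q, Continuous fun x : ℝ => E (Matrix.scalar (Fin m) x + A) p q := by
    intro p q
    simp only [hE]
    exact (hc.matrix_fromBlocks continuous_const continuous_const continuous_const).matrix_det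
  have key := Continuous.ext_on hd
    (f := fun x : ℝ => (Matrix.scalar (Fin m) x + A).det *
      (fromBlocks (Matrix.scalar (Fin m) x + A) B C D).det)
    (g := fun x : ℝ => E (Matrix.scalar (Fin m) x + A) 0 0 * E (Matrix.scalar (Fin m) x + A) 1 1
      - E (Matrix.scalar (Fin m) x + A) 0 1 * E (Matrix.scalar (Fin m) x + A) 1 0)
    (hc.matrix_det.mul
      (hc.matrix_fromBlocks continuous_const continuous_const continuous_const).matrix_det)
    (((hEc 0 0).mul (hEc 1 1)).sub ((hEc 0 1).mul (hEc 1 0)))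
    (fun x hx => dj_inv _ B C D (E _) (hE _) hx)
  have := congrFun key 0
  simpa using this

open Matrix in
lemma dj' {m : ℕ} (A : Matrix (Fin m) (Fin m) ℝ) (B : Matrix (Fin m) (Fin 2) ℝ)
    (C : Matrix (Fin 2) (Fin m) ℝ) (D : Matrix (Fin 2) (Fin 2) ℝ)
    (E : Fin 2 → Fin 2 → ℝ)
    (hE : ∀ p q, E p q = (fromBlocks A (B.submatrix id (fun _ : Fin 1 => q))
      (C.submatrix (fun _ : Fin 1 => p) id)
      (D.submatrix (fun _ : Fin 1 => p) (fun _ : Fin 1 => q))).det) :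
    A.det * (fromBlocks A B C D).det = E 0 0 * E 1 1 - E 0 1 * E 1 0 := by
  rw [hE, hE, hE, hE]
  exact dj A B C D _ (fun _ _ _ => rfl)

lemma hasDerivAt_det {l : ℕ} (M M' : ℝ → Matrix (Fin l) (Fin l) ℝ) (t : ℝ)
    (h : ∀ p q, HasDerivAt (fun s => M s p q) (M' t p q) t) :
    HasDerivAt (fun s => (M s).det)
      (∑ q, ((M t).updateCol q (fun p => M' t p q)).det) t := by
  simp only [Matrix.det_apply]
  rw [Finset.sum_comm]
  refine HasDerivAt.fun_sum fun σ _ => ?_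
  rw [← Finset.smul_sum]
  have h1 := HasDerivAt.fun_finsetProd (u := Finset.univ) (x := t)
    (f := fun (q : Fin l) s => M s (σ q) q) (f' := fun q => M' t (σ q) q) (fun q _ => h _ _)
  have h2 := h1.const_smul (Equiv.Perm.sign σ)
  refine h2.congr_deriv ?_
  congr 1
  refine Finset.sum_congr rfl fun q _ => ?_
  rw [← Finset.prod_erase_mul _ _ (Finset.mem_univ q)]
  simp only [Matrix.updateCol_self, smul_eq_mul]
  congr 1
  refine Finset.prod_congr rfl fun x hx => ?_
  rw [Matrix.updateCol_ne (Finset.ne_of_mem_erase hx)]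

lemma hasDerivAt_Lg (n m : ℕ) (ζ : Fin n → ℝ → ℝ) (hζ : ∀ p, ContDiff ℝ (⊤ : ℕ∞) (ζ p))
    (ρ : Fin (m + 1) → Fin n) (t : ℝ) :
    HasDerivAt (Lg n (m + 1) ζ ρ)
      (Matrix.det (Matrix.of fun p q : Fin (m + 1) =>
        iteratedDeriv ((if q = Fin.last m then m + 1 else (q : ℕ)) + 1) (ζ (ρ p)) t)) t := by
  have h := hasDerivAt_det
    (fun s => Matrix.of fun p q : Fin (m + 1) => iteratedDeriv ((q : ℕ) + 1) (ζ (ρ p)) s)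
    (fun s => Matrix.of fun p q : Fin (m + 1) => iteratedDeriv ((q : ℕ) + 2) (ζ (ρ p)) s) t
    (by
      intro p q
      simp only [Matrix.of_apply]
      have hd : Differentiable ℝ (iteratedDeriv ((q : ℕ) + 1) (ζ (ρ p))) :=
        (hζ (ρ p)).differentiable_iteratedDeriv _ (by exact_mod_cast WithTop.coe_lt_top _)
      have := (hd t).hasDerivAt
      rwa [← iteratedDeriv_succ] at this)
  refine h.congr_deriv ?_
  rw [Fin.sum_univ_castSucc, Finset.sum_eq_zero, zero_add]
  · congr 1
    ext p q
    by_cases hq : q = Fin.last m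
    · subst hq; simp
    · simp [hq]
  · intro q _
    refine Matrix.det_zero_of_column_eq (i := q.castSucc) (j := q.succ)
      (Fin.castSucc_lt_succ).ne ?_
    intro p
    rw [Matrix.updateCol_self, Matrix.updateCol_ne (Fin.castSucc_lt_succ).ne']
    simp

/-- The key differential identity (from Sylvester's identity and the quotient rule):
if `L_j = L_{ζ_1 ⋯ ζ_j}` never vanishes on the open interval `I`, then
`(L_{ζ_1 ⋯ ζ_{j-1} ζ_i} / L_{ζ_1 ⋯ ζ_j})' =
  L_{ζ_1 ⋯ ζ_{j-1}} · L_{ζ_1 ⋯ ζ_j ζ_i} / (L_{ζ_1 ⋯ ζ_j})²`.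
Here `j = j' + 1` and `i` is a row index beyond the first `j`. -/
theorem statement9 (n : ℕ) (ζ : Fin n → ℝ → ℝ) (hζ : ∀ p, ContDiff ℝ (⊤ : ℕ∞) (ζ p))
    (I : Set ℝ) (hIopen : IsOpen I) (hIconv : Convex ℝ I)
    (j' : ℕ) (i : Fin n) (hjn : j' + 1 ≤ n) (hij : j' + 1 ≤ (i : ℕ))
    (hL : ∀ t ∈ I, Lg n (j' + 1) ζ (Fin.castLE hjn) t ≠ 0) :
    ∀ t ∈ I,
      deriv (fun s =>
          Lg n (j' + 1) ζ (Fin.snoc (Fin.castLE (by omega : j' ≤ n)) i) s /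
            Lg n (j' + 1) ζ (Fin.castLE hjn) s) t =
        Lg n j' ζ (Fin.castLE (by omega : j' ≤ n)) t *
            Lg n (j' + 2) ζ (Fin.snoc (Fin.castLE hjn) i) t /
          (Lg n (j' + 1) ζ (Fin.castLE hjn) t) ^ 2 := by
  intro t ht
  have hf := hasDerivAt_Lg n j' ζ hζ (Fin.snoc (Fin.castLE (by omega : j' ≤ n)) i) t
  have hg := hasDerivAt_Lg n j' ζ hζ (Fin.castLE hjn) t
  rw [(hf.fun_div hg (hL t ht)).deriv]
  congr 1
  let r : Fin 2 → Fin n := ![Fin.castLE hjn (Fin.last j'), i]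
  let c : Fin 2 → ℕ := ![j', j' + 1]
  have hs : (Fin.castLE hjn : Fin (j' + 1) → Fin n) =
      Fin.snoc (Fin.castLE (by omega : j' ≤ n)) (Fin.castLE hjn (Fin.last j')) := by
    ext p
    refine Fin.lastCases ?_ (fun p => ?_) p <;> simp
  have e1 : ∀ (k : Fin n) (d : ℕ), Matrix.det (Matrix.of fun p q : Fin (j' + 1) =>
        iteratedDeriv ((if q = Fin.last j' then d else (q : ℕ)) + 1)
          (ζ ((Fin.snoc (Fin.castLE (by omega : j' ≤ n)) k : Fin (j' + 1) → Fin n) p)) t) =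
      (Matrix.fromBlocks (Matrix.of fun p q : Fin j' => iteratedDeriv ((q : ℕ) + 1)
          (ζ (Fin.castLE (by omega : j' ≤ n) p)) t)
        (Matrix.of fun (p : Fin j') (_ : Fin 1) => iteratedDeriv (d + 1)
          (ζ (Fin.castLE (by omega : j' ≤ n) p)) t)
        (Matrix.of fun (_ : Fin 1) (q : Fin j') => iteratedDeriv ((q : ℕ) + 1) (ζ k) t)
        (Matrix.of fun (_ : Fin 1) (_ : Fin 1) => iteratedDeriv (d + 1) (ζ k) t)).det := by
    intro k d
    rw [← Matrix.det_submatrix_equiv_self (finSumFinEquiv (m := j') (n := 1))]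
    congr 1
    have hl : ∀ x : Fin 1, Fin.natAdd j' x = Fin.last j' := by
      intro x; ext; simp
    have hcs : ∀ x : Fin j', Fin.castAdd 1 x = Fin.castSucc x := fun x => rfl
    have hne : ∀ x : Fin j', Fin.castSucc x ≠ Fin.last j' := fun x => (Fin.castSucc_lt_last x).ne
    ext p q
    rcases p with p | p <;> rcases q with q | q <;>
      simp only [Matrix.submatrix_apply, Matrix.of_apply, finSumFinEquiv_apply_left,
        finSumFinEquiv_apply_right, Matrix.fromBlocks_apply₁₁, Matrix.fromBlocks_apply₁₂,
        Matrix.fromBlocks_apply₂₁, Matrix.fromBlocks_apply₂₂, hl, hcs, Fin.snoc_castSucc,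
        Fin.snoc_last, hne, if_true, if_false, Fin.val_castSucc]
  have e0 : ∀ k : Fin n, Lg n (j' + 1) ζ (Fin.snoc (Fin.castLE (by omega : j' ≤ n)) k) t =
      Matrix.det (Matrix.of fun p q : Fin (j' + 1) =>
        iteratedDeriv ((if q = Fin.last j' then j' else (q : ℕ)) + 1)
          (ζ ((Fin.snoc (Fin.castLE (by omega : j' ≤ n)) k : Fin (j' + 1) → Fin n) p)) t) := by
    intro k
    unfold Lg
    congr 1
    ext p q
    by_cases hq : q = Fin.last j'
    · subst hq; simp
    · simp [hq]
  have e2 : Lg n (j' + 2) ζ (Fin.snoc (Fin.castLE hjn) i) t = (Matrix.fromBlocks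
    (Matrix.of fun p q : Fin j' => iteratedDeriv ((q : ℕ) + 1)
      (ζ (Fin.castLE (by omega : j' ≤ n) p)) t)
    (Matrix.of fun (p : Fin j') (q : Fin 2) => iteratedDeriv (c q + 1)
      (ζ (Fin.castLE (by omega : j' ≤ n) p)) t)
    (Matrix.of fun (p : Fin 2) (q : Fin j') => iteratedDeriv ((q : ℕ) + 1) (ζ (r p)) t)
    (Matrix.of fun (p : Fin 2) (q : Fin 2) => iteratedDeriv (c q + 1) (ζ (r p)) t)).det := by
    unfold Lg
    rw [← Matrix.det_submatrix_equiv_self (finSumFinEquiv (m := j') (n := 2))]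
    congr 1
    have hc : ∀ x : Fin 2, ((Fin.natAdd j' x : Fin (j' + 2)) : ℕ) = c x := by
      intro x; fin_cases x <;> simp [c]
    have hr : ∀ x : Fin 2, (Fin.snoc (Fin.castLE hjn) i : Fin (j' + 2) → Fin n)
        (Fin.natAdd j' x) = r x := by
      intro x
      fin_cases x
      · exact Fin.snoc_castSucc (α := fun _ => Fin n) i (Fin.castLE hjn) (Fin.last j')
      · exact Fin.snoc_last (α := fun _ => Fin n) i (Fin.castLE hjn)
    have hl : ∀ x : Fin j', (Fin.snoc (Fin.castLE hjn) i : Fin (j' + 2) → Fin n)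
        (Fin.castAdd 2 x) = Fin.castLE (by omega : j' ≤ n) x := by
      intro x
      exact Fin.snoc_castSucc (α := fun _ => Fin n) i (Fin.castLE hjn) (Fin.castSucc x)
    ext p q
    rcases p with p | p <;> rcases q with q | q <;>
      simp only [Matrix.submatrix_apply, Matrix.of_apply, finSumFinEquiv_apply_left,
        finSumFinEquiv_apply_right, Matrix.fromBlocks_apply₁₁, Matrix.fromBlocks_apply₁₂,
        Matrix.fromBlocks_apply₂₁, Matrix.fromBlocks_apply₂₂, hl, hr, hc, Fin.val_castAdd]
  have key := dj'
    (Matrix.of fun p q : Fin j' => iteratedDeriv ((q : ℕ) + 1)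
      (ζ (Fin.castLE (by omega : j' ≤ n) p)) t)
    (Matrix.of fun (p : Fin j') (q : Fin 2) => iteratedDeriv (c q + 1)
      (ζ (Fin.castLE (by omega : j' ≤ n) p)) t)
    (Matrix.of fun (p : Fin 2) (q : Fin j') => iteratedDeriv ((q : ℕ) + 1) (ζ (r p)) t)
    (Matrix.of fun (p : Fin 2) (q : Fin 2) => iteratedDeriv (c q + 1) (ζ (r p)) t)
    (fun a b => Matrix.det (Matrix.of fun p q : Fin (j' + 1) =>
        iteratedDeriv ((if q = Fin.last j' then c b else (q : ℕ)) + 1)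
          (ζ ((Fin.snoc (Fin.castLE (by omega : j' ≤ n)) (r a) : Fin (j' + 1) → Fin n) p)) t))
    (fun a b => e1 (r a) (c b))
  rw [hs, e0, e0, ← hs, e2]
  refine Eq.trans ?_ key.symm
  simp only [r, c, Matrix.cons_val_zero, Matrix.cons_val_one, ← hs]
  ring
end
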